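/- For all n ≥ 8, there exists an n-column Order-Regular matrix with at least (33^(1/10))^(n-7) rows, i.e., Ω(1.4186^n) rows. -/

import Mathlib

/-- Successor row index, saturating at the last row (convention `A[m+1] = A[m]`). -/
def rowSucc {m : ℕ} (i : Fin m) : Fin m :=
  if h : i.1 + 1 < m then ⟨i.1 + 1, h⟩ else i

/-- The matrix `A` satisfies the Order-Regularity constraint for the pair of rows `(i, j)`:
there is a column `k` with `A[i,k] ≠ A[i+1,k] = A[j,k] = A[j+1,k]`. -/
def SatCon {m n : ℕ} (A : Fin m → Fin n → Bool) (i j : Fin m) : Prop :=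
  ∃ k : Fin n, A i k ≠ A (rowSucc i) k ∧ A (rowSucc i) k = A j k ∧ A j k = A (rowSucc j) k

/-- Order-Regularity: every pair of rows `i < j` satisfies the constraint, and the last two
rows are distinct. -/
def OrderRegular {m n : ℕ} (A : Fin m → Fin n → Bool) : Prop :=
  (∀ i j : Fin m, i < j → SatCon A i j) ∧
  ∀ _h : 2 ≤ m, A ⟨m - 2, by omega⟩ ≠ A ⟨m - 1, by omega⟩

/-- Even-position vectors of the nine blocks (as bit masks). -/
def blkP : ℕ → ℕ
  | 0 => 25 | 1 => 39 | 2 => 27 | 3 => 46 | 4 => 28 | 5 => 23 | 6 => 7 | 7 => 1 | _ => 0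

/-- Odd-position vectors of the nine blocks (as bit masks). -/
def blkQ : ℕ → ℕ
  | 0 => 38 | 1 => 9 | 2 => 6 | 3 => 26 | 4 => 53 | 5 => 13 | 6 => 11 | 7 => 2 | _ => 0

/-- Source of a step of kind `x` in block `s`. -/
def stepU (s x : ℕ) : ℕ := if x = 1 then blkQ s else blkP s

/-- Target of a step of kind `x` in block `s`. -/
def stepV (s x : ℕ) : ℕ := if x = 0 then blkQ s else if x = 1 then blkP s else blkP (s + 1)

set_option maxRecDepth 100000 in
theorem blk_fin : ∀ t s : Fin 9, s < t → ∀ x y : Fin 3, ∃ k : Fin 6,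
    (stepU s x).testBit k ≠ (stepV s x).testBit k ∧
    (stepV s x).testBit k = (stepU t y).testBit k ∧
    (stepU t y).testBit k = (stepV t y).testBit k := by
  decide +kernel

theorem blk_ok (t : ℕ) (ht : t < 9) (s : ℕ) (hs : s < t) (x : ℕ) (hx : x < 3) (y : ℕ)
    (hy : y < 3) : ∃ k < 6,
    (stepU s x).testBit k ≠ (stepV s x).testBit k ∧
    (stepV s x).testBit k = (stepU t y).testBit k ∧
    (stepU t y).testBit k = (stepV t y).testBit k := by
  obtain ⟨k, hk⟩ := blk_fin ⟨t, ht⟩ ⟨s, by omega⟩ hs ⟨x, hx⟩ ⟨y, hy⟩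
  exact ⟨k.1, k.2, hk⟩

/-- Order-Regularity for matrices indexed by natural numbers. -/
def NOR (m n : ℕ) (A : ℕ → ℕ → Bool) : Prop :=
  ∀ i j, i < j → j < m → ∃ k < n, A i k ≠ A (i + 1) k ∧ A (i + 1) k = A j k ∧
    A j k = A (min (j + 1) (m - 1)) k

/-- Block vectors of the blowup. -/
def blkE (m r : ℕ) : ℕ := if (r % m) % 2 = 1 then blkQ (r / m) else blkP (r / m)

/-- The blowup: nine copies of `A`, with six more columns. -/
def blow (m n : ℕ) (A : ℕ → ℕ → Bool) (r k : ℕ) : Bool :=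
  if k < n then xor (A (r % m) k) (decide ((r / m) % 2 = 1) && xor (A 0 k) (A (m - 1) k))
  else (blkE m r).testBit (k - n)

theorem dm_eq (m s i : ℕ) (hi : i < m) : (s * m + i) / m = s ∧ (s * m + i) % m = i := by
  have hm : 0 < m := by omega
  constructor
  · rw [mul_comm, Nat.mul_add_div hm, Nat.div_eq_of_lt hi, add_zero]
  · rw [mul_comm, Nat.mul_add_mod, Nat.mod_eq_of_lt hi]

theorem dm_next (m s i : ℕ) (hi : i + 1 = m) :
    (s * m + i + 1) / m = s + 1 ∧ (s * m + i + 1) % m = 0 := by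
  have h : s * m + i + 1 = (s + 1) * m + 0 := by rw [add_mul]; omega
  rw [h]; exact dm_eq m (s + 1) 0 (by omega)

theorem blkE_step (m : ℕ) (hodd : m % 2 = 1) (s i : ℕ) (hs : s < 9) (hi : i < m) :
    ∃ x < 3, blkE m (s * m + i) = stepU s x ∧
      blkE m (min (s * m + i + 1) (9 * m - 1)) = stepV s x := by
  obtain ⟨h1, h2⟩ := dm_eq m s i hi
  have hle : (s + 1) * m ≤ 9 * m := Nat.mul_le_mul_right m (by omega)
  rw [add_mul] at hle
  by_cases hl : i + 1 < m
  · have hmin : min (s * m + i + 1) (9 * m - 1) = s * m + (i + 1) := by omega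
    obtain ⟨h3, h4⟩ := dm_eq m s (i + 1) hl
    rw [hmin]
    simp only [blkE, h1, h2, h3, h4]
    rcases Nat.mod_two_eq_zero_or_one i with h | h
    · refine ⟨0, by omega, ?_⟩
      have h' : (i + 1) % 2 = 1 := by omega
      simp [stepU, stepV, h, h']
    · refine ⟨1, by omega, ?_⟩
      have h' : (i + 1) % 2 = 0 := by omega
      simp [stepU, stepV, h, h']
  · have him : i + 1 = m := by omega
    have hi2 : i % 2 = 0 := by omega
    refine ⟨2, by omega, ?_, ?_⟩
    · simp [blkE, h1, h2, stepU, hi2]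
    · by_cases hs8 : s = 8
      · subst hs8
        have hmin : min (8 * m + i + 1) (9 * m - 1) = 8 * m + i := by omega
        rw [hmin]
        simp [blkE, h1, h2, stepV, hi2, blkP]
      · have hle : (s + 2) * m ≤ 9 * m := Nat.mul_le_mul_right m (by omega)
        rw [add_mul] at hle
        have hmin : min (s * m + i + 1) (9 * m - 1) = s * m + i + 1 := by omega
        obtain ⟨h3, h4⟩ := dm_next m s i him
        rw [hmin]
        simp [blkE, h3, h4, stepV]

theorem blow_NOR (m n : ℕ) (A : ℕ → ℕ → Bool) (hodd : m % 2 = 1) (hA : NOR m n A) :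
    NOR (9 * m) (n + 6) (blow m n A) := by
  intro a b hab hb
  have hm : 0 < m := by omega
  obtain ⟨s, i, hi, rfl⟩ : ∃ s i, i < m ∧ a = s * m + i :=
    ⟨a / m, a % m, Nat.mod_lt _ hm, by rw [mul_comm]; exact (Nat.div_add_mod a m).symm⟩
  obtain ⟨t, j, hj, rfl⟩ : ∃ s i, i < m ∧ b = s * m + i :=
    ⟨b / m, b % m, Nat.mod_lt _ hm, by rw [mul_comm]; exact (Nat.div_add_mod b m).symm⟩
  have ht : t < 9 := by
    by_contra h
    have : 9 * m ≤ t * m := Nat.mul_le_mul_right m (by omega)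
    omega
  have hst : s ≤ t := by
    by_contra h
    have : (t + 1) * m ≤ s * m := Nat.mul_le_mul_right m (by omega)
    rw [add_mul] at this
    omega
  rcases Nat.lt_or_eq_of_le hst with hlt | rfl
  · obtain ⟨x, hx, hx1, hx2⟩ := blkE_step m hodd s i (by omega) hi
    obtain ⟨y, hy, hy1, hy2⟩ := blkE_step m hodd t j ht hj
    obtain ⟨k, hk, hk1, hk2, hk3⟩ := blk_ok t ht s hlt x hx y hy
    have hmin : min (s * m + i + 1) (9 * m - 1) = s * m + i + 1 := by omega
    rw [hmin] at hx2
    rw [← hx1, ← hx2] at hk1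
    rw [← hx2, ← hy1] at hk2
    rw [← hy1, ← hy2] at hk3
    refine ⟨n + k, by omega, ?_⟩
    have hnk : ¬ (n + k < n) := by omega
    simp only [blow, hnk, if_false, Nat.add_sub_cancel_left]
    exact ⟨hk1, hk2, hk3⟩
  · have hij : i < j := by omega
    obtain ⟨k, hk, hk1, hk2, hk3⟩ := hA i j hij hj
    refine ⟨k, by omega, ?_⟩
    obtain ⟨a1, a2⟩ := dm_eq m s i hi
    obtain ⟨b1, b2⟩ := dm_eq m s j hj
    obtain ⟨c1, c2⟩ := dm_eq m s (i + 1) (by omega)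
    have hlast : blow m n A (min (s * m + j + 1) (9 * m - 1)) k =
        xor (A (min (j + 1) (m - 1)) k)
          (decide (s % 2 = 1) && xor (A 0 k) (A (m - 1) k)) := by
      have hle : (s + 1) * m ≤ 9 * m := Nat.mul_le_mul_right m (by omega)
      rw [add_mul] at hle
      by_cases hl : j + 1 < m
      · have hmin : min (s * m + j + 1) (9 * m - 1) = s * m + (j + 1) := by omega
        have hmin2 : min (j + 1) (m - 1) = j + 1 := by omega
        obtain ⟨h3, h4⟩ := dm_eq m s (j + 1) hl
        rw [hmin, hmin2]
        simp only [blow, hk, if_true, h3, h4]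
      · have hmin2 : min (j + 1) (m - 1) = m - 1 := by omega
        rw [hmin2]
        by_cases hs8 : s = 8
        · subst hs8
          have hmin : min (8 * m + j + 1) (9 * m - 1) = 8 * m + j := by omega
          have hjm : j = m - 1 := by omega
          rw [hmin]
          simp only [blow, hk, if_true, b1, b2]
          rw [hjm]
        · have hle : (s + 2) * m ≤ 9 * m := Nat.mul_le_mul_right m (by omega)
          rw [add_mul] at hle
          have hmin : min (s * m + j + 1) (9 * m - 1) = s * m + j + 1 := by omega
          obtain ⟨h3, h4⟩ := dm_next m s j (by omega)
          rw [hmin]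
          simp only [blow, hk, if_true, h3, h4]
          rcases Nat.mod_two_eq_zero_or_one s with h | h
          · have h' : (s + 1) % 2 = 1 := by omega
            simp [h, h']
          · have h' : (s + 1) % 2 = 0 := by omega
            simp [h, h']
            cases A 0 k <;> cases A (m - 1) k <;> rfl
    rw [hlast, add_assoc]
    simp only [blow, hk, if_true, a1, a2, b1, b2, c1, c2]
    rw [← hk3, ← hk2]
    refine ⟨?_, rfl, rfl⟩
    intro h
    exact hk1 (by simpa using h)

theorem base_NOR (n : ℕ) (hn : 8 ≤ n) : NOR 9 n (fun i k => decide (k < i)) := by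
  intro i j hij hj
  refine ⟨i, by omega, ?_⟩
  have h1 : i < min (j + 1) (9 - 1) := by omega
  simp [hij]
  omega

theorem OR_of_NOR (m n : ℕ) (A : ℕ → ℕ → Bool) (h : NOR m n A) :
    OrderRegular (fun (i : Fin m) (k : Fin n) => A i k) := by
  constructor
  · intro i j hij
    have hij' : i.1 < j.1 := hij
    obtain ⟨k, hk, h1, h2, h3⟩ := h i j hij' j.2
    have hi : (rowSucc i).1 = i.1 + 1 := by
      have : i.1 + 1 < m := by omega
      simp [rowSucc, this]
    have hjs : (rowSucc j).1 = min (j.1 + 1) (m - 1) := by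
      unfold rowSucc
      split_ifs with hh
      · simp only; omega
      · omega
    refine ⟨⟨k, hk⟩, ?_⟩
    simp only [hi, hjs]
    exact ⟨h1, h2, h3⟩
  · intro hm heq
    obtain ⟨k, hk, h1, -, -⟩ := h (m - 2) (m - 1) (by omega) (by omega)
    have := congrFun heq ⟨k, hk⟩
    simp only at this
    have e : m - 2 + 1 = m - 1 := by omega
    rw [e] at h1
    exact h1 this

theorem exists_NOR (l : ℕ) : ∀ n, 8 + 6 * l ≤ n → ∃ A, NOR (9 ^ (l + 1)) n A := by
  induction l with
  | zero => intro n hn; exact ⟨_, base_NOR n (by omega)⟩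
  | succ l ih =>
    intro n hn
    obtain ⟨A, hA⟩ := ih (n - 6) (by omega)
    have hodd : 9 ^ (l + 1) % 2 = 1 := by rw [Nat.pow_mod]; simp
    have := blow_NOR _ _ A hodd hA
    rw [show n - 6 + 6 = n by omega] at this
    refine ⟨blow (9 ^ (l + 1)) (n - 6) A, ?_⟩
    rw [pow_succ, mul_comm]
    exact this

theorem stmt11 : ∀ n : ℕ, 8 ≤ n → ∃ (m : ℕ) (A : Fin m → Fin n → Bool),
    OrderRegular A ∧ ((33 : ℝ) ^ ((1 : ℝ) / 10)) ^ (n - 7) ≤ (m : ℝ) := by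
  intro n hn
  obtain ⟨A, hA⟩ := exists_NOR ((n - 8) / 6) n (by omega)
  refine ⟨_, _, OR_of_NOR _ _ A hA, ?_⟩
  set c : ℝ := (33 : ℝ) ^ ((1 : ℝ) / 10) with hc
  have hc0 : 0 ≤ c := by positivity
  have hc10 : c ^ 10 = 33 := by
    rw [hc, ← Real.rpow_natCast, ← Real.rpow_mul (by norm_num)]; norm_num
  have hc1 : 1 ≤ c := Real.one_le_rpow (by norm_num) (by norm_num)
  have hc6 : c ^ 6 ≤ 9 := by
    have : (c ^ 6) ^ 5 ≤ 9 ^ 5 := by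
      calc (c ^ 6) ^ 5 = (c ^ 10) ^ 3 := by ring
        _ ≤ 9 ^ 5 := by rw [hc10]; norm_num
    exact le_of_pow_le_pow_left₀ (by norm_num) (by norm_num) this
  push_cast
  calc c ^ (n - 7) ≤ c ^ (6 * ((n - 8) / 6 + 1)) := pow_le_pow_right₀ hc1 (by omega)
    _ = (c ^ 6) ^ ((n - 8) / 6 + 1) := by rw [pow_mul]
    _ ≤ 9 ^ ((n - 8) / 6 + 1) := pow_le_pow_left₀ (by positivity) hc6 _
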